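/- Define the 3×3 complex-matrix-valued functions A_z, A_{z̃}, P, Q of (z, z̃) by: P has a single nonzero entry P_{13} = 1; Q has single nonzero entry Q_{31} = e^u; A_z has entries (A_z)_{11} = u_z, (A_z)_{21} = 1, (A_z)_{22} = −u_z, (A_z)_{32} = 1, rest zero; A_{z̃} has entries (A_{z̃})_{12} = e^{−2u}, (A_{z̃})_{23} = e^u, rest zero; where u = u(z, z̃) is a smooth complex function. Then the Hitchin equations ∂_z Q − ∂_{z̃}·0 + [A_z, Q] = 0 (i.e. D_z Q = 0), D_{z̃} P = 0, and F_{zz̃} + [P,Q] = 0 hold if and only if u satisfies the holomorphic Tzitzéica equation u_{zz̃} = e^u − e^{−2u}. -/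

import Mathlib

/-- Partial derivative `∂_z` of a function of two independent complex variables. -/
noncomputable def pdz (f : ℂ × ℂ → ℂ) (p : ℂ × ℂ) : ℂ :=
  deriv (fun t => f (t, p.2)) p.1

/-- Partial derivative `∂_z̃`. -/
noncomputable def pdzt (f : ℂ × ℂ → ℂ) (p : ℂ × ℂ) : ℂ :=
  deriv (fun t => f (p.1, t)) p.2

/-- Entrywise `∂_z` of a matrix-valued function. -/
noncomputable def pdzM (M : ℂ × ℂ → Matrix (Fin 3) (Fin 3) ℂ) (p : ℂ × ℂ) :
    Matrix (Fin 3) (Fin 3) ℂ :=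
  Matrix.of fun i j => pdz (fun q => M q i j) p

/-- Entrywise `∂_z̃` of a matrix-valued function. -/
noncomputable def pdztM (M : ℂ × ℂ → Matrix (Fin 3) (Fin 3) ℂ) (p : ℂ × ℂ) :
    Matrix (Fin 3) (Fin 3) ℂ :=
  Matrix.of fun i j => pdzt (fun q => M q i j) p

theorem aux_slice1 (u : ℂ × ℂ → ℂ) (hu : Differentiable ℂ u) (w : ℂ) :
    Differentiable ℂ (fun z => u (z, w)) :=
  hu.comp (differentiable_id.prodMk (differentiable_const w))

theorem aux_slice2 (u : ℂ × ℂ → ℂ) (hu : Differentiable ℂ u) (z : ℂ) :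
    Differentiable ℂ (fun w => u (z, w)) :=
  hu.comp ((differentiable_const z).prodMk differentiable_id)

open Filter Topology in
theorem aux_cont (u : ℂ × ℂ → ℂ) (hu : Differentiable ℂ u) : Continuous (pdzt u) := by
  rw [continuous_iff_continuousAt]
  rintro ⟨z₀, w₀⟩
  have h1 : TendstoLocallyUniformlyOn (fun (p : ℂ × ℂ) t => u (p.1, t)) (fun t => u (z₀, t))
      (𝓝 (z₀, w₀)) Set.univ := by
    rw [Metric.tendstoLocallyUniformlyOn_iff]
    intro ε hε t _
    have hc := hu.continuous.continuousAt (x := (z₀, t))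
    obtain ⟨δ, hδ, H⟩ := Metric.continuousAt_iff.1 hc (ε / 2) (by positivity)
    refine ⟨Metric.ball t δ, mem_nhdsWithin_of_mem_nhds (Metric.ball_mem_nhds t hδ), ?_⟩
    filter_upwards [Metric.ball_mem_nhds (z₀, w₀) hδ] with p hp y hy
    have hp1 : dist p.1 z₀ < δ := lt_of_le_of_lt (le_max_left _ _) hp
    have a := @H (z₀, y) (by simpa [Prod.dist_eq, hδ] using hy)
    have b := @H (p.1, y) (by rw [Prod.dist_eq]; exact max_lt hp1 hy)
    calc _ ≤ _ := dist_triangle_right _ _ (u (z₀, t))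
      _ < ε := by linarith
  have h2 := h1.deriv (Eventually.of_forall fun p =>
    (aux_slice2 u hu p.1).differentiableOn) isOpen_univ
  have hcd : Continuous (deriv fun t => u (z₀, t)) :=
    ((aux_slice2 u hu z₀).contDiff (n := 1)).continuous_deriv le_rfl
  have := h2.tendsto_comp (x := w₀) hcd.continuousWithinAt (Set.mem_univ _)
    (g := Prod.snd) (by rw [nhdsWithin_univ]; exact continuous_snd.tendsto _)
  exact this

open Filter Topology in
theorem aux_symm (u : ℂ × ℂ → ℂ) (hu : Differentiable ℂ u) (p : ℂ × ℂ) :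
    pdzt (pdz u) p = pdz (pdzt u) p := by
  obtain ⟨z, w⟩ := p
  have h1 : TendstoLocallyUniformlyOn (fun (t : ℂ) x => (t - w)⁻¹ * (u (x, t) - u (x, w)))
      (fun x => pdzt u (x, w)) (𝓝[≠] w) Set.univ := by
    rw [Metric.tendstoLocallyUniformlyOn_iff]
    intro ε hε z₀ _
    obtain ⟨δ, hδ, H⟩ := Metric.continuousAt_iff.1
      ((aux_cont u hu).continuousAt (x := (z₀, w))) (ε / 4) (by positivity)
    refine ⟨Metric.ball z₀ δ, mem_nhdsWithin_of_mem_nhds (Metric.ball_mem_nhds _ hδ), ?_⟩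
    filter_upwards [mem_nhdsWithin_of_mem_nhds (Metric.ball_mem_nhds w hδ),
      self_mem_nhdsWithin] with t ht htw x hx
    have hne : t - w ≠ 0 := sub_ne_zero.2 htw
    have key := (convex_ball w δ).norm_image_sub_le_of_norm_hasDerivWithin_le
      (f := fun s => u (x, s) - s * pdzt u (x, w))
      (f' := fun s => pdzt u (x, s) - 1 * pdzt u (x, w)) (C := ε / 2)
      (fun s _ => (((aux_slice2 u hu x) s).hasDerivAt.sub
        ((hasDerivAt_id s).mul_const _)).hasDerivWithinAt)
      (fun s hs => by
        have a := @H (x, s) (by rw [Prod.dist_eq]; exact max_lt hx hs)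
        have b := @H (x, w) (by rw [Prod.dist_eq]; exact max_lt hx (by simpa using hδ))
        rw [one_mul, ← dist_eq_norm]
        have := dist_triangle_right (pdzt u (x, s)) (pdzt u (x, w)) (pdzt u (z₀, w))
        linarith) (Metric.mem_ball_self hδ) ht
    rw [dist_comm, dist_eq_norm]
    have e : (t - w)⁻¹ * (u (x, t) - u (x, w)) - pdzt u (x, w) =
      (t - w)⁻¹ * ((u (x, t) - t * pdzt u (x, w)) - (u (x, w) - w * pdzt u (x, w))) := by
      field_simp
      ring
    rw [e, norm_mul, norm_inv]
    have hpos : 0 < ‖t - w‖ := norm_pos_iff.2 hne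
    calc _ ≤ ‖t - w‖⁻¹ * (ε / 2 * ‖t - w‖) := by gcongr
      _ = ε / 2 := by field_simp
      _ < ε := by linarith
  have h2 := h1.deriv (Eventually.of_forall fun t =>
    (((aux_slice1 u hu t).sub (aux_slice1 u hu w)).const_mul _).differentiableOn) isOpen_univ
  have h3 := h2.tendsto_at (Set.mem_univ z)
  have h4 : HasDerivAt (fun t => pdz u (z, t)) (pdz (pdzt u) (z, w)) w := by
    rw [hasDerivAt_iff_tendsto_slope]
    refine h3.congr fun t => ?_
    have := ((((aux_slice1 u hu t) z).hasDerivAt.sub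
      ((aux_slice1 u hu w) z).hasDerivAt).const_mul ((t - w)⁻¹)).deriv
    simp only [slope_def_field, Function.comp]
    refine this.trans ?_
    simp only [pdz]
    rw [div_eq_inv_mul]
  exact h4.deriv

theorem aux_exp (u : ℂ × ℂ → ℂ) (hu : Differentiable ℂ u) (p : ℂ × ℂ) :
    pdz (fun q => Complex.exp (u q)) p = Complex.exp (u p) * pdz u p :=
  ((aux_slice1 u hu p.2) p.1).hasDerivAt.cexp.deriv

theorem aux_exp2 (u : ℂ × ℂ → ℂ) (hu : Differentiable ℂ u) (p : ℂ × ℂ) :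
    pdz (fun q => Complex.exp (-(2 * u q))) p = Complex.exp (-(2 * u p)) * (-(2 * pdz u p)) :=
  (((aux_slice1 u hu p.2) p.1).hasDerivAt.const_mul 2).neg.cexp.deriv

theorem aux_neg (f : ℂ × ℂ → ℂ) (p : ℂ × ℂ) :
    pdzt (fun q => -f q) p = -pdzt f p := by
  simp [pdzt]

theorem aux_c1 (c : ℂ) (p : ℂ × ℂ) : pdz (fun _ => c) p = 0 := by simp [pdz]
theorem aux_c2 (c : ℂ) (p : ℂ × ℂ) : pdzt (fun _ => c) p = 0 := by simp [pdzt]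


theorem aux_M1 (M : ℂ × ℂ → Matrix (Fin 3) (Fin 3) ℂ) (p : ℂ × ℂ) (i j : Fin 3) :
    pdzM M p i j = pdz (fun q => M q i j) p := rfl

theorem aux_M2 (M : ℂ × ℂ → Matrix (Fin 3) (Fin 3) ℂ) (p : ℂ × ℂ) (i j : Fin 3) :
    pdztM M p i j = pdzt (fun q => M q i j) p := rfl

/-- With the ansatz `P₁₃ = 1`, `Q₃₁ = e^u`,
`A_z = [[u_z,0,0],[1,−u_z,0],[0,1,0]]`, `A_{z̃} = [[0,e^{−2u},0],[0,0,e^u],[0,0,0]]`,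
the Hitchin equations `D_z Q = 0`, `D_{z̃} P = 0`, `F_{zz̃} + [P,Q] = 0` hold iff
`u` satisfies the holomorphic Tzitzéica equation `u_{zz̃} = e^u − e^{−2u}`. -/
theorem stmt9 (u : ℂ × ℂ → ℂ) (hu : Differentiable ℂ u)
    (P Q Az Azt : ℂ × ℂ → Matrix (Fin 3) (Fin 3) ℂ)
    (hP : ∀ p, P p = !![0, 0, 1; 0, 0, 0; 0, 0, 0])
    (hQ : ∀ p, Q p = !![0, 0, 0; 0, 0, 0; Complex.exp (u p), 0, 0])
    (hAz : ∀ p, Az p = !![pdz u p, 0, 0; 1, -(pdz u p), 0; 0, 1, 0])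
    (hAzt : ∀ p, Azt p =
      !![0, Complex.exp (-2 * u p), 0; 0, 0, Complex.exp (u p); 0, 0, 0]) :
    ((∀ p, pdzM Q p + (Az p * Q p - Q p * Az p) = 0) ∧
     (∀ p, pdztM P p + (Azt p * P p - P p * Azt p) = 0) ∧
     (∀ p, pdzM Azt p - pdztM Az p + (Az p * Azt p - Azt p * Az p)
        + (P p * Q p - Q p * P p) = 0))
    ↔ (∀ p, pdz (pdzt u) p = Complex.exp (u p) - Complex.exp (-2 * u p)) := by
  have hs := aux_symm u hu
  have he := aux_exp u hu
  have he2 := aux_exp2 u hu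
  have heta : ∀ p, pdzt (fun q => pdz u q) p = pdz (pdzt u) p := hs
  constructor
  · rintro ⟨-, -, h⟩ p
    have := congrFun (congrFun (h p) 0) 0
    simp only [Matrix.add_apply, Matrix.sub_apply, aux_M1, aux_M2, Matrix.mul_apply,
      Fin.sum_univ_three, Matrix.zero_apply] at this
    simp [hP, hQ, hAz, hAzt, aux_c1, aux_c2,
      heta] at this
    simp only [neg_mul]
    linear_combination -this
  · intro h
    refine ⟨fun p => ?_, fun p => ?_, fun p => ?_⟩
    · ext i j
      simp only [Matrix.add_apply, Matrix.sub_apply, aux_M1, aux_M2, Matrix.mul_apply,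
      Fin.sum_univ_three, Matrix.zero_apply]
      fin_cases i <;> fin_cases j <;>
        simp [hQ, hAz, aux_c1, he]
    · ext i j
      simp only [Matrix.add_apply, Matrix.sub_apply, aux_M1, aux_M2, Matrix.mul_apply,
      Fin.sum_univ_three, Matrix.zero_apply]
      fin_cases i <;> fin_cases j <;>
        simp [hP, hAzt, aux_c2]
    · ext i j
      simp only [Matrix.add_apply, Matrix.sub_apply, aux_M1, aux_M2, Matrix.mul_apply,
      Fin.sum_univ_three, Matrix.zero_apply]
      fin_cases i <;> fin_cases j <;>
        simp [hP, hQ, hAz, hAzt, aux_c1,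
          aux_c2, he, he2, aux_neg, heta, h] <;> try ring
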